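/- Let k be a number field containing a primitive d-th root of unity, where d ≥ 2, let c ∈ k, and let f(x) = x^d + c. Suppose that 0 is not preperiodic under f, i.e., f^{∘m}(0) ≠ f^{∘n}(0) for all integers m > n ≥ 0. Then for every N ≥ 1, the Galois group of a splitting field of f^{∘N}(x) − t over k(t) has order d^{(d^N − 1)/(d − 1)}; that is, it is isomorphic to the N-fold wreath product [C_d]^N of the cyclic group of order d. -/

import Mathlib

open Polynomial

namespace Unicrit

set_option linter.unusedSectionVars false
set_option linter.unusedSimpArgs false

/-- The iterates of a polynomial. -/
noncomputable def itp {A : Type*} [CommRing A] (f : A[X]) (j : ℕ) : A[X] :=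
  (fun g => f.comp g)^[j] X

section itp
variable {A B : Type*} [CommRing A] [CommRing B]

lemma itp_zero (f : A[X]) : itp f 0 = X := rfl

lemma itp_succ (f : A[X]) (j : ℕ) : itp f (j + 1) = f.comp (itp f j) := by
  simp [itp, Function.iterate_succ_apply']

lemma itp_succ' (f : A[X]) (j : ℕ) : itp f (j + 1) = (itp f j).comp f := by
  induction j with
  | zero => simp [itp]
  | succ j ih => rw [itp_succ, ih, ← comp_assoc, ← itp_succ, ih]

lemma itp_map (φ : A →+* B) (f : A[X]) (j : ℕ) : (itp f j).map φ = itp (f.map φ) j := by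
  induction j with
  | zero => simp [itp]
  | succ j ih => rw [itp_succ, itp_succ, Polynomial.map_comp, ih]

lemma itp_eval (f : A[X]) (j : ℕ) (z : A) :
    (itp f j).eval z = (fun z => f.eval z)^[j] z := by
  induction j with
  | zero => simp [itp]
  | succ j ih => rw [itp_succ, eval_comp, ih, Function.iterate_succ_apply']

lemma itp_monic_deg [Nontrivial A] (f : A[X]) (hf : f.Monic) (hd : f.natDegree ≠ 0) (j : ℕ) :
    (itp f j).Monic ∧ (itp f j).natDegree = f.natDegree ^ j := by
  induction j with
  | zero => simp [itp_zero, monic_X]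
  | succ j ih =>
    rw [itp_succ']
    refine ⟨ih.1.comp hf hd, ?_⟩
    rw [natDegree_comp_eq_of_mul_ne_zero, ih.2, pow_succ]
    simp [hf.leadingCoeff, ih.1.leadingCoeff]

lemma itp_deriv {κ : Type*} [Field κ] [CharZero κ] (d : ℕ) (hd : 2 ≤ d) (c : κ) (j : ℕ) (z : κ)
    (h : ∀ i < j, (itp (X ^ d + C c) i).eval z ≠ 0) :
    (derivative (itp (X ^ d + C c) j)).eval z ≠ 0 := by
  induction j with
  | zero => simp [itp_zero]
  | succ j ih =>
    rw [itp_succ, derivative_comp, eval_mul]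
    refine mul_ne_zero (ih fun i hi => h i (by omega)) ?_
    have := h j (by omega)
    have hd0 : (d : κ) ≠ 0 := by exact_mod_cast (by omega : d ≠ 0)
    simp [derivative_X_pow, eval_comp, hd0, this]

end itp

section ps
variable {κ : Type*} [Field κ]

open PowerSeries in
lemma ps_root [IsAlgClosed κ] [CharZero κ] {d : ℕ} (hd : d ≠ 0) (v : κ⟦X⟧)
    (hv : constantCoeff v ≠ 0) : ∃ w : κ⟦X⟧, w ^ d = v := by
  obtain ⟨z, hz⟩ := IsAlgClosed.exists_pow_nat_eq (constantCoeff v) (Nat.pos_of_ne_zero hd)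
  have hz0 : z ≠ 0 := by rintro rfl; simp [hd] at hz; exact hv hz.symm
  have hd0 : (d : κ) ≠ 0 := by exact_mod_cast hd
  obtain ⟨a, ha, -⟩ := HenselianRing.is_henselian (I := Ideal.span {(PowerSeries.X : κ⟦X⟧)})
    (Polynomial.X ^ d - Polynomial.C v) (monic_X_pow_sub_C _ hd) (PowerSeries.C z)
    (by
      rw [Ideal.mem_span_singleton, PowerSeries.X_dvd_iff]
      simp [hz])
    (by
      apply IsUnit.map
      rw [PowerSeries.isUnit_iff_constantCoeff]
      simp [derivative_X_pow, hd0, hz0])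
  refine ⟨a, ?_⟩
  simpa [sub_eq_zero] using ha

open PowerSeries in
lemma ps_cc_aeval (Q : κ[X]) (x : κ⟦X⟧) :
    constantCoeff (aeval x Q) = Q.eval (constantCoeff x) := by
  rw [aeval_def, hom_eval₂]
  have : (PowerSeries.constantCoeff (R := κ)).comp (algebraMap κ κ⟦X⟧) = RingHom.id κ := by
    ext; simp [PowerSeries.algebraMap_apply]
  rw [this, eval₂_id]

open PowerSeries in
lemma ps_factor (Q : κ[X]) (x y : κ⟦X⟧) (h : constantCoeff x = constantCoeff y) :
    ∃ v : κ⟦X⟧, constantCoeff v = Q.derivative.eval (constantCoeff x) ∧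
      aeval x Q - aeval y Q = (x - y) * v := by
  obtain ⟨k, hk⟩ := binomExpansion (Q.map (algebraMap κ κ⟦X⟧)) y (x - y)
  refine ⟨aeval y Q.derivative + k * (x - y), ?_, ?_⟩
  · rw [map_add, ps_cc_aeval]; simp [h]
  · rw [derivative_map, add_sub_cancel] at hk
    simp only [eval_map_algebraMap] at hk
    rw [hk]; ring

open PowerSeries in
lemma ps_simple (Q : κ[X]) (x y : κ⟦X⟧) (h : constantCoeff x = constantCoeff y)
    (hQ : aeval x Q = aeval y Q) (hd : Q.derivative.eval (constantCoeff x) ≠ 0) : x = y := by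
  obtain ⟨v, hv, e⟩ := ps_factor Q x y h
  rw [hQ, sub_self] at e
  rcases mul_eq_zero.1 e.symm with e | e
  · exact sub_eq_zero.1 e
  · rw [e] at hv; simp at hv; exact absurd hv.symm hd

variable [IsAlgClosed κ] [CharZero κ] (d : ℕ) (hd : 2 ≤ d) (c : κ)
  (hw : ∀ m n : ℕ, n < m → (itp (X ^ d + C c) m).eval 0 ≠ (itp (X ^ d + C c) n).eval 0)

include hd in
lemma itp_succ_zero (j : ℕ) :
    (itp (X ^ d + C c) (j + 1)).eval 0 = (itp (X ^ d + C c) j).eval c := by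
  rw [itp_succ', eval_comp]; simp [show d ≠ 0 by omega]

lemma itp_add (f : κ[X]) (i j : ℕ) (z : κ) :
    (itp f (i + j)).eval z = (itp f i).eval ((itp f j).eval z) := by
  simp only [itp_eval, Function.iterate_add_apply]

include hd hw in
/-- simple points above the critical value -/
lemma deriv_ne (n j : ℕ) (z : κ) (hj : j ≤ n + 1)
    (hz : (itp (X ^ d + C c) j).eval z = (itp (X ^ d + C c) (n + 1)).eval 0)
    (h0 : j = n + 1 → z ≠ 0) :
    (derivative (itp (X ^ d + C c) j)).eval z ≠ 0 := by
  apply itp_deriv d hd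
  intro i hi h
  obtain ⟨l, rfl⟩ := Nat.exists_eq_add_of_le' hi.le
  rw [itp_add, h] at hz
  rcases Nat.lt_or_ge l (n + 1) with hl | hl
  · exact hw _ _ hl hz.symm
  · have : i = 0 := by omega
    subst this
    exact h0 (by omega) (by simpa [itp_zero] using h)

/-- The polynomial `f^j - (a + u^d)` over power series. -/
noncomputable def PP (n j : ℕ) : (PowerSeries κ)[X] :=
  (itp (X ^ d + C c) j).map (algebraMap κ (PowerSeries κ)) -
    C (PowerSeries.C ((itp (X ^ d + C c) (n + 1)).eval 0) + PowerSeries.X ^ d)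

lemma PP_eval (n j : ℕ) (x : PowerSeries κ) : (PP d c n j).eval x = 0 ↔
    aeval x (itp (X ^ d + C c) j) =
      PowerSeries.C ((itp (X ^ d + C c) (n + 1)).eval 0) + PowerSeries.X ^ d := by
  rw [PP, eval_sub, eval_map_algebraMap, eval_C, sub_eq_zero]

lemma PP_succ (n j : ℕ) : PP d c n (j + 1) =
    (PP d c n j).comp (X ^ d + C (algebraMap κ (PowerSeries κ) c)) := by
  simp [PP, itp_succ', Polynomial.map_comp]

include hd in
lemma PP_monic (n j : ℕ) : (PP d c n j).Monic := by
  have hf : (X ^ d + C c : κ[X]).natDegree = d := natDegree_X_pow_add_C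
  obtain ⟨h1, h2⟩ := itp_monic_deg (X ^ d + C c : κ[X]) (monic_X_pow_add_C _ (by omega))
    (by rw [hf]; omega) j
  unfold PP
  apply (h1.map _).sub_of_left
  apply lt_of_le_of_lt degree_C_le
  rw [← natDegree_pos_iff_degree_pos, h1.natDegree_map, h2, hf]
  positivity

include hd in
lemma PP_cc (n j : ℕ) (x : PowerSeries κ) (h : (PP d c n j).eval x = 0) :
    (itp (X ^ d + C c) j).eval (PowerSeries.constantCoeff x) =
      (itp (X ^ d + C c) (n + 1)).eval 0 := by
  rw [PP_eval] at h
  have := congrArg PowerSeries.constantCoeff h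
  rw [ps_cc_aeval] at this
  simpa [show d ≠ 0 by omega] using this

include hd hw in
lemma PP_c_factor (n : ℕ) (x : PowerSeries κ) (h : (PP d c n n).eval x = 0)
    (hx : PowerSeries.constantCoeff x = c) :
    ∃ v : PowerSeries κ, PowerSeries.constantCoeff v ≠ 0 ∧
      x - PowerSeries.C c = PowerSeries.X ^ d * v := by
  obtain ⟨v, hv, e⟩ := ps_factor (itp (X ^ d + C c) n) x (PowerSeries.C c) (by simpa using hx)
  have hne := deriv_ne d hd c hw n n _ (by omega) (PP_cc d hd c n n x h) (by omega)
  rw [← hv] at hne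
  have hc : aeval (PowerSeries.C c) (itp (X ^ d + C c) n) =
      PowerSeries.C ((itp (X ^ d + C c) (n + 1)).eval 0) := by
    rw [itp_succ_zero d hd, show PowerSeries.C c = algebraMap κ (PowerSeries κ) c from rfl,
      aeval_algebraMap_apply, coe_aeval_eq_eval]; rfl
  rw [(PP_eval d c n n x).1 h, hc, add_sub_cancel_left] at e
  refine ⟨v⁻¹, by simpa using hne, ?_⟩
  rw [e, mul_assoc, PowerSeries.mul_inv_cancel _ hne, mul_one]

include hd hw in
lemma PP_splits (ζ : κ) (hζ : IsPrimitiveRoot ζ d) (n j : ℕ) (hj : j ≤ n + 1) :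
    (PP d c n j).Splits := by
  induction j with
  | zero => simp only [PP, itp_zero, map_X]; exact Splits.X_sub_C _
  | succ j ih =>
    rw [PP_succ, (ih (by omega)).eq_prod_roots_of_monic (PP_monic d hd c n j), multiset_prod_comp]
    apply Splits.multisetProd
    intro g hg
    simp only [Multiset.mem_map, exists_exists_and_eq_and] at hg
    obtain ⟨α, hα, rfl⟩ := hg
    have hα' : (PP d c n j).eval α = 0 := (mem_roots'.1 hα).2
    have e : ((X - C α).comp (X ^ d + C (algebraMap κ (PowerSeries κ) c))) =
        X ^ d - C (α - PowerSeries.C c) := by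
      simp; ring
    rw [e]
    obtain ⟨β, hβ⟩ : ∃ β, β ^ d = α - PowerSeries.C c := by
      by_cases hc : PowerSeries.constantCoeff α = c
      · have hjn : j = n := by
          by_contra hne
          have h1 := PP_cc d hd c n j α hα'
          rw [hc, ← itp_succ_zero d hd] at h1
          exact hw _ _ (by omega) h1.symm
        subst hjn
        obtain ⟨v, hv, e⟩ := PP_c_factor d hd c hw j α hα' hc
        obtain ⟨w, hw⟩ := ps_root (d := d) (by omega) v hv
        exact ⟨PowerSeries.X * w, by rw [mul_pow, hw, e]⟩
      · exact ps_root (by omega) _ (by simpa [sub_eq_zero] using hc)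
    have hζ' : IsPrimitiveRoot (PowerSeries.C ζ) d :=
      hζ.map_of_injective (PowerSeries.C_injective)
    rw [X_pow_sub_C_eq_prod hζ' (by omega) hβ]
    exact Splits.prod fun i _ => Splits.X_sub_C _

include hd hw in
lemma PP_action (ζ : κ) (hζ : IsPrimitiveRoot ζ d) (n : ℕ) :
    ∃ α₁ : PowerSeries κ, (PP d c n n).eval α₁ = 0 ∧
      ∀ β : PowerSeries κ, (PP d c n (n + 1)).eval β = 0 →
        (β ^ d + PowerSeries.C c = α₁ → PowerSeries.rescale ζ β = PowerSeries.C ζ * β) ∧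
        (β ^ d + PowerSeries.C c ≠ α₁ → PowerSeries.rescale ζ β = β) := by
  have hd0 : d ≠ 0 := by omega
  have hresc : ∀ j x, (PP d c n j).eval x = 0 →
      (PP d c n j).eval (PowerSeries.rescale ζ x) = 0 := by
    intro j x hx
    rw [PP_eval] at hx ⊢
    have h1 := congrArg (PowerSeries.rescale ζ) hx
    rw [aeval_def, hom_eval₂] at h1
    have h2 : (PowerSeries.rescale ζ).comp (algebraMap κ (PowerSeries κ)) =
        algebraMap κ (PowerSeries κ) := by
      ext a m
      rw [RingHom.comp_apply, PowerSeries.coeff_rescale]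
      simp only [PowerSeries.algebraMap_apply, Algebra.algebraMap_self, RingHom.id_apply,
        PowerSeries.coeff_C]
      split_ifs with h <;> simp [h]
    have h3 : ∀ a : κ, PowerSeries.rescale ζ (PowerSeries.C a) = PowerSeries.C a :=
      fun a => congrArg (fun g => g a) h2
    rw [h2, ← aeval_def] at h1
    rw [h1, map_add, h3, map_pow, PowerSeries.rescale_X, mul_pow, ← map_pow, hζ.pow_eq_one]
    simp
  have hcc : ∀ x : PowerSeries κ, PowerSeries.constantCoeff (PowerSeries.rescale ζ x) =
      PowerSeries.constantCoeff x := by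
    intro x
    rw [← PowerSeries.coeff_zero_eq_constantCoeff_apply, PowerSeries.coeff_rescale]; simp
  -- existence of the special root
  obtain ⟨α₁, hα₁, hα₁c⟩ : ∃ α₁ : PowerSeries κ, (PP d c n n).eval α₁ = 0 ∧
      PowerSeries.constantCoeff α₁ = c := by
    by_contra! hcon
    have h1 := (PP_splits d hd c hw ζ hζ n n (by omega)).eval_eq_prod_roots_of_monic
      (PP_monic d hd c n n) (PowerSeries.C c)
    have h2 := congrArg PowerSeries.constantCoeff h1
    rw [map_multiset_prod] at h2
    have h3 : PowerSeries.constantCoeff ((PP d c n n).eval (PowerSeries.C c)) = 0 := by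
      simp only [PP, eval_sub, eval_C, eval_map_algebraMap, map_sub, ps_cc_aeval, map_add,
        PowerSeries.constantCoeff_C, itp_succ_zero d hd]
      simp [hd0]
    rw [h3, eq_comm, Multiset.prod_eq_zero_iff] at h2
    simp only [Multiset.mem_map, exists_exists_and_eq_and] at h2
    obtain ⟨α, hα, h4⟩ := h2
    refine hcon α (mem_roots'.1 hα).2 ?_
    rw [map_sub, PowerSeries.constantCoeff_C, sub_eq_zero] at h4
    exact h4.symm
  have huniq : ∀ α, (PP d c n n).eval α = 0 → PowerSeries.constantCoeff α = c → α = α₁ := by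
    intro α hα hαc
    refine ps_simple (itp (X ^ d + C c) n) _ _ (by rw [hαc, hα₁c]) ?_ 
      (deriv_ne d hd c hw n n _ (by omega) (PP_cc d hd c n n _ hα) (by omega))
    rw [(PP_eval d c n n α).1 hα, (PP_eval d c n n α₁).1 hα₁]
  refine ⟨α₁, hα₁, fun β hβ => ⟨fun hβα => ?_, fun hβα => ?_⟩⟩
  · obtain ⟨v, hv, e⟩ := PP_c_factor d hd c hw n α₁ hα₁ hα₁c
    have hβd : β ^ d = PowerSeries.X ^ d * v := by rw [← e, ← hβα]; ring
    have hfix : PowerSeries.rescale ζ α₁ = α₁ := huniq _ (hresc _ _ hα₁) (by rw [hcc, hα₁c])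
    have h3 : PowerSeries.rescale ζ (PowerSeries.C c) = PowerSeries.C c := by
      ext m
      rw [PowerSeries.coeff_rescale, PowerSeries.coeff_C]
      split_ifs with h <;> simp [h]
    have hpow : (PowerSeries.rescale ζ β) ^ d = β ^ d := by
      have := congrArg (PowerSeries.rescale ζ) hβα
      rw [hfix, ← hβα, map_add, map_pow, h3] at this
      exact add_right_cancel this
    have hζ' : IsPrimitiveRoot (PowerSeries.C ζ) d :=
      hζ.map_of_injective (PowerSeries.C_injective)
    have hXβ : PowerSeries.X ∣ β := by
      rw [PowerSeries.X_dvd_iff]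
      have := congrArg PowerSeries.constantCoeff hβd
      simpa [hd0] using this
    obtain ⟨y, rfl⟩ := hXβ
    have hy : PowerSeries.constantCoeff y ≠ 0 := by
      rw [mul_pow] at hβd
      have h5 := mul_left_cancel₀ (pow_ne_zero d PowerSeries.X_ne_zero) hβd
      intro h0
      apply hv
      rw [← h5]; simp [h0, hd0]
    rw [map_mul, PowerSeries.rescale_X] at hpow ⊢
    have hpow' : (PowerSeries.rescale ζ y) ^ d = y ^ d := by
      rw [mul_pow, mul_pow, hζ'.pow_eq_one, one_mul, mul_pow] at hpow
      exact mul_left_cancel₀ (pow_ne_zero d PowerSeries.X_ne_zero) hpow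
    have : PowerSeries.rescale ζ y = y := by
      refine ps_simple (X ^ d) _ _ (hcc y) (by simpa using hpow') ?_
      have hdk : (d : κ) ≠ 0 := by exact_mod_cast hd0
      simp [derivative_X_pow, hcc, hy, hdk]
    rw [this, mul_assoc]
  · refine ps_simple (itp (X ^ d + C c) (n + 1)) _ _ (hcc β) ?_ ?_
    · rw [(PP_eval d c n _ _).1 hβ, (PP_eval d c n _ _).1 (hresc _ _ hβ)]
    · refine deriv_ne d hd c hw n _ _ le_rfl (PP_cc d hd c n _ _ (hresc _ _ hβ)) ?_
      rw [hcc]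
      rintro - h0
      apply hβα
      apply huniq
      · rw [PP_succ, eval_comp] at hβ
        simpa using! hβ
      · simp [h0, hd0]

end ps

section count
variable {K E : Type*} [Field K] [Field E] [Algebra K E]

lemma aeval_q (c : K) (d : ℕ) (β : E) :
    aeval β (X ^ d + C c : K[X]) = β ^ d + algebraMap K E c := by simp

lemma ker_card (p : K[X]) (d : ℕ) (hd : 0 < d) (ζ : K) (hζ : IsPrimitiveRoot ζ d) (c : K)
    (hp : Irreducible p) (hsep : p.Separable) (hc : p.eval c ≠ 0)
    [hE : IsSplittingField K E (p.comp (X ^ d + C c))]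
    (hpE : (p.map (algebraMap K E)).Splits)
    (τ : E ≃ₐ[K] E) (α₁ : E) (hα₁ : aeval α₁ p = 0)
    (hτ : ∀ β : E, aeval β (p.comp (X ^ d + C c)) = 0 →
      (β ^ d + algebraMap K E c = α₁ → τ β = algebraMap K E ζ * β) ∧
      (β ^ d + algebraMap K E c ≠ α₁ → τ β = β))
    (H : Subgroup (E ≃ₐ[K] E)) (hH : ∀ σ, σ ∈ H ↔ ∀ α : E, aeval α p = 0 → σ α = α) :
    Nat.card H = d ^ p.natDegree := by
  classical
  have hp0 : p ≠ 0 := hp.ne_zero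
  have hd0 : d ≠ 0 := hd.ne'
  have : NeZero d := ⟨hd0⟩
  set q : K[X] := X ^ d + C c with hq
  have hqd : q.natDegree = d := natDegree_X_pow_add_C
  have hpq0 : p.comp q ≠ 0 := by
    intro h
    rcases comp_eq_zero_iff.1 h with h | ⟨-, h⟩
    · exact hp0 h
    · rw [h, natDegree_C] at hqd; omega
  set ζE : E := algebraMap K E ζ with hζE
  have hζE' : IsPrimitiveRoot ζE d := hζ.map_of_injective (algebraMap K E).injective
  have hσζ : ∀ σ : E ≃ₐ[K] E, σ ζE = ζE := fun σ => σ.commutes ζ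
  have hσc : ∀ σ : E ≃ₐ[K] E, σ (algebraMap K E c) = algebraMap K E c := fun σ => σ.commutes c
  have hroot : ∀ β : E, aeval β (p.comp q) = 0 ↔ aeval (β ^ d + algebraMap K E c) p = 0 := by
    intro β; rw [aeval_comp, hq, aeval_q]
  have hσroot : ∀ (σ : E ≃ₐ[K] E) (r : K[X]) (β : E), aeval β r = 0 → aeval (σ β) r = 0 := by
    intro σ r β h
    have := aeval_algHom_apply σ.toAlgHom β r
    rw [h, map_zero] at this
    exact this
  -- choose d-th roots
  have hex : ∀ α : E, aeval α p = 0 → ∃ β : E, β ^ d + algebraMap K E c = α := by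
    intro α hα
    have hαint : (minpoly K α) = p * C p.leadingCoeff⁻¹ := (minpoly.eq_of_irreducible hp hα).symm
    -- a root of `q - α` in the splitting field
    have hspl : ((p.comp q).map (algebraMap K E)).Splits := hE.splits'
    have hdvd : (q.map (algebraMap K E) - C α) ∣ (p.comp q).map (algebraMap K E) := by
      rw [Polynomial.map_comp]
      have h1 : (X - C α) ∣ p.map (algebraMap K E) := by
        rw [dvd_iff_isRoot, IsRoot, eval_map_algebraMap, hα]
      obtain ⟨r, hr⟩ := h1
      rw [hr, mul_comp]
      simp
    have hs2 := hspl.of_dvd (Polynomial.map_ne_zero hpq0) hdvd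
    obtain ⟨β, hβ⟩ := hs2.exists_eval_eq_zero (by
      have h1 : (q.map (algebraMap K E) - C α) = X ^ d - C (α - algebraMap K E c) := by
        simp [hq]; ring
      rw [h1, degree_X_pow_sub_C hd]
      exact_mod_cast hd0)
    refine ⟨β, ?_⟩
    rw [eval_sub, eval_map_algebraMap, eval_C, hq, aeval_q, sub_eq_zero] at hβ
    exact hβ
  have hne : ∀ α β : E, aeval α p = 0 → β ^ d + algebraMap K E c = α → β ≠ 0 := by
    rintro α β hα hβ rfl
    rw [zero_pow hd0, zero_add] at hβ
    rw [← hβ, aeval_algebraMap_apply, coe_aeval_eq_eval, map_eq_zero] at hα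
    exact hc hα
  have hmem : ∀ α : p.rootSet E, aeval (α : E) p = 0 := fun α => (mem_rootSet.1 α.2).2
  choose b hb using fun α : p.rootSet E => hex α (hmem α)
  have hb0 : ∀ α, b α ≠ 0 := fun α => hne α _ (hmem α) (hb α)
  -- elements with equal d-th power
  have hpow : ∀ x y : E, y ≠ 0 → x ^ d = y ^ d → ∃ i : ℕ, x = ζE ^ i * y := by
    intro x y hy hxy
    have h1 : (x / y) ^ d = 1 := by rw [div_pow, hxy, div_self (pow_ne_zero _ hy)]
    obtain ⟨i, -, hi⟩ := hζE'.eq_pow_of_pow_eq_one h1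
    exact ⟨i, by rw [hi, div_mul_cancel₀ _ hy]⟩
  have hHpow : ∀ σ ∈ H, ∀ α, (σ (b α)) ^ d = (b α) ^ d := by
    intro σ hσ α
    have h1 := (hH σ).1 hσ α (hmem α)
    rw [← hb α, map_add, map_pow, hσc] at h1
    exact add_right_cancel h1
  have hHu : ∀ (σ : H) α, ((σ : E ≃ₐ[K] E) (b α) / b α) ^ d = 1 := by
    intro σ α
    rw [div_pow, hHpow σ σ.2, div_self (pow_ne_zero _ (hb0 α))]
  let Φ : H →* (p.rootSet E → rootsOfUnity d E) := MonoidHom.mk'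
    (fun σ α => rootsOfUnity.mkOfPowEq ((σ : E ≃ₐ[K] E) (b α) / b α) (hHu σ α)) (by
      intro σ ρ
      funext α
      apply rootsOfUnity.coe_injective
      simp only [Pi.mul_apply, rootsOfUnity.val_mkOfPowEq_coe, Subgroup.coe_mul, Units.val_mul,
        AlgEquiv.mul_apply]
      obtain ⟨i, hi⟩ := hpow _ _ (hb0 α) (hHpow ρ ρ.2 α)
      rw [hi, map_mul, map_pow, hσζ, mul_div_assoc, mul_div_assoc, div_self (hb0 α)]
      ring)
  have hΦ : ∀ σ α, ((Φ σ α : Eˣ) : E) = (σ : E ≃ₐ[K] E) (b α) / b α := by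
    intro σ α
    simp [Φ]
  have hinj : Function.Injective Φ := by
    intro σ ρ h
    have hbb : ∀ α, (σ : E ≃ₐ[K] E) (b α) = (ρ : E ≃ₐ[K] E) (b α) := by
      intro α
      have h1 : ((Φ σ α : Eˣ) : E) = (Φ ρ α : Eˣ) := by rw [h]
      rw [hΦ, hΦ] at h1
      exact (div_left_inj' (hb0 α)).1 h1
    have hall : ∀ β : E, aeval β (p.comp q) = 0 → (σ : E ≃ₐ[K] E) β = (ρ : E ≃ₐ[K] E) β := by
      intro β hβ
      rw [hroot] at hβ
      let α : p.rootSet E := ⟨_, mem_rootSet.2 ⟨hp0, hβ⟩⟩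
      obtain ⟨i, hi⟩ := hpow β (b α) (hb0 α) (add_right_cancel (hb α).symm)
      rw [hi, map_mul, map_mul, map_pow, map_pow, hσζ, hσζ, hbb]
    apply Subtype.ext
    have h1 : (σ : E ≃ₐ[K] E).toAlgHom = (ρ : E ≃ₐ[K] E).toAlgHom := by
      apply AlgHom.ext_of_adjoin_eq_top (IsSplittingField.adjoin_rootSet E (p.comp q))
      intro β hβ
      exact hall β (mem_rootSet.1 hβ).2
    ext x
    exact DFunLike.congr_fun h1 x
  have hnormal : Normal K E := Normal.of_isSplittingField (p.comp q)
  have hsingle : ∀ α : p.rootSet E, ∃ σ : H, Φ σ = Pi.mulSingle α hζE'.toRootsOfUnity := by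
    intro α
    obtain ⟨g, hg⟩ := (Normal.minpoly_eq_iff_mem_orbit (F := K) E (x := α) (y := α₁)).1 (by
      rw [← minpoly.eq_of_irreducible hp (hmem α), ← minpoly.eq_of_irreducible hp hα₁])
    replace hg : g α₁ = α := hg
    have hgsymm : ∀ β : E, (g.symm β) ^ d + algebraMap K E c =
        g.symm (β ^ d + algebraMap K E c) := by
      intro β; rw [map_add, map_pow, hσc]
    have hact : ∀ β : E, aeval β (p.comp q) = 0 →
      (β ^ d + algebraMap K E c = α → (g * τ * g⁻¹) β = ζE * β) ∧
      (β ^ d + algebraMap K E c ≠ α → (g * τ * g⁻¹) β = β) := by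
      intro β hβ
      have h1 := hτ (g.symm β) (hσroot g.symm _ β hβ)
      rw [hgsymm] at h1
      have e : (g * τ * g⁻¹) β = g (τ (g.symm β)) := rfl
      rw [e]
      constructor
      · intro h
        rw [h1.1 (by rw [h, ← hg, AlgEquiv.symm_apply_apply]), map_mul, hσζ,
          AlgEquiv.apply_symm_apply]
      · intro h
        rw [h1.2 (by rintro h'; apply h; rw [← hg, ← h', AlgEquiv.apply_symm_apply]),
          AlgEquiv.apply_symm_apply]
    have hbr : ∀ α', aeval (b α') (p.comp q) = 0 := fun α' => by
      rw [hroot, hb]; exact hmem α'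
    have hinH : g * τ * g⁻¹ ∈ H := by
      rw [hH]
      intro α' hα'
      obtain ⟨β, rfl⟩ := hex α' hα'
      have h1 := hact β ((hroot β).2 hα')
      rw [map_add, map_pow, hσc]
      by_cases h : β ^ d + algebraMap K E c = α
      · rw [h1.1 h, mul_pow, hζE'.pow_eq_one, one_mul]
      · rw [h1.2 h]
    refine ⟨⟨_, hinH⟩, ?_⟩
    funext α'
    apply rootsOfUnity.coe_injective
    change ((Φ _ α' : Eˣ) : E) = _
    rw [hΦ]
    by_cases h : α' = α
    · subst h
      rw [Pi.mulSingle_eq_same, (hact _ (hbr _)).1 (hb _), mul_div_assoc, div_self (hb0 _), mul_one]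
      rfl
    · rw [Pi.mulSingle_eq_of_ne h, (hact _ (hbr _)).2 (by rw [hb]; exact fun h' => h (Subtype.ext h')),
        div_self (hb0 _)]
      rfl
  have hsurj : Function.Surjective Φ := by
    rw [← MonoidHom.range_eq_top, eq_top_iff]
    intro x _
    apply Subgroup.pi_mem_of_mulSingle_mem
    intro α
    obtain ⟨σ, hσ⟩ := hsingle α
    have h1 : ((x α : Eˣ) : E) ^ d = 1 := by
      have := (x α).2
      rw [mem_rootsOfUnity] at this
      have := congrArg Units.val this
      rwa [Units.val_pow_eq_pow_val, Units.val_one] at this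
    obtain ⟨i, -, hi⟩ := hζE'.eq_pow_of_pow_eq_one h1
    have h2 : x α = hζE'.toRootsOfUnity ^ i := by
      apply rootsOfUnity.coe_injective
      change ((x α : Eˣ) : E) = _
      rw [← hi]
      change _ = (((hζE'.toRootsOfUnity ^ i : rootsOfUnity d E) : Eˣ) : E)
      simp
    rw [h2, Pi.mulSingle_pow, ← hσ]
    exact ⟨σ ^ i, map_pow Φ σ i⟩
  rw [Nat.card_eq_of_bijective Φ ⟨hinj, hsurj⟩, Nat.card_fun,
    hζE'.card_rootsOfUnity, Nat.card_eq_fintype_card, card_rootSet_eq_natDegree hsep hpE]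

lemma gal_card_succ (p : K[X]) (d : ℕ) (hd : 0 < d) (ζ : K) (hζ : IsPrimitiveRoot ζ d) (c : K)
    (hp : Irreducible p) (hsep : p.Separable) (hc : p.eval c ≠ 0)
    (hτ : ∃ τ : (p.comp (X ^ d + C c)).Gal, ∃ α₁ : (p.comp (X ^ d + C c)).SplittingField,
      aeval α₁ p = 0 ∧
      ∀ β : (p.comp (X ^ d + C c)).SplittingField, aeval β (p.comp (X ^ d + C c)) = 0 →
      (β ^ d + algebraMap K _ c = α₁ → τ β = algebraMap K _ ζ * β) ∧
      (β ^ d + algebraMap K _ c ≠ α₁ → τ β = β)) :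
    Nat.card (p.comp (X ^ d + C c)).Gal = Nat.card p.Gal * d ^ p.natDegree := by
  have hqd : (X ^ d + C c : K[X]).natDegree ≠ 0 := by rw [natDegree_X_pow_add_C]; omega
  have hspl := Gal.splits_in_splittingField_of_comp p _ hqd
  obtain ⟨τ, α₁, hα₁, hτ⟩ := hτ
  have hsurj := Gal.restrictComp_surjective p _ hqd
  have hk : ∀ σ : (p.comp (X ^ d + C c)).Gal, σ ∈ (Gal.restrictComp p _ hqd).ker ↔
      ∀ α : (p.comp (X ^ d + C c)).SplittingField, aeval α p = 0 → σ α = α := by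
    intro σ
    have : Fact (Splits (p.map (algebraMap K (p.comp (X ^ d + C c)).SplittingField))) := ⟨hspl⟩
    have e : Gal.restrictComp p _ hqd σ = Gal.restrict p _ σ := rfl
    rw [MonoidHom.mem_ker, e]
    constructor
    · intro h α hα
      have := Gal.restrict_smul (p := p) σ ⟨α, mem_rootSet.2 ⟨hp.ne_zero, hα⟩⟩
      rw [h, one_smul] at this
      exact this.symm
    · intro h
      apply Gal.galActionHom_injective p (p.comp (X ^ d + C c)).SplittingField
      ext x
      have := Gal.restrict_smul (p := p) σ x
      replace this := this.trans (h x (mem_rootSet.1 x.2).2)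
      rw [map_one]
      exact this
  have h1 : Nat.card (Gal.restrictComp p (X ^ d + C c) hqd).ker = d ^ p.natDegree :=
    ker_card (E := (p.comp (X ^ d + C c)).SplittingField) p d hd ζ hζ c hp hsep hc hspl
      τ α₁ hα₁ hτ (Gal.restrictComp p _ hqd).ker hk
  rw [Subgroup.card_eq_card_quotient_mul_card_subgroup (Gal.restrictComp p _ hqd).ker, h1,
    Nat.card_congr (QuotientGroup.quotientKerEquivOfSurjective _ hsurj).toEquiv]

end count

section transfer

lemma base_general {K M : Type*} [Field K] [Field M] [Algebra K M] (P : K[X])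
    (hs : (P.map (algebraMap K M)).Splits) (T : M →ₐ[K] M) :
    ∃ φ : P.SplittingField →ₐ[K] M, ∃ τ : P.Gal, ∀ x, φ (τ x) = T (φ x) := by
  have : Fact ((P.map (algebraMap K M)).Splits) := ⟨hs⟩
  refine ⟨IsScalarTower.toAlgHom K P.SplittingField M, T.restrictNormal' P.SplittingField, ?_⟩
  intro x
  exact AlgHom.restrictNormal_commutes T P.SplittingField x

lemma transfer {K R M : Type*} [Field K] [CommRing R] [IsDomain R] [Field M] [Algebra R M]
    (hRM : Function.Injective (algebraMap R M)) (ι : K →+* M) (T : M →+* M) (hT : T.comp ι = ι)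
    (ρ : R → R) (hρ : ∀ x, T (algebraMap R M x) = algebraMap R M (ρ x))
    (p : K[X]) (hp0 : p ≠ 0) (d : ℕ) (hd : 0 < d) (c ζ : K) (cR ζR : R)
    (hc : ι c = algebraMap R M cR) (hζ : ι ζ = algebraMap R M ζR) (Q Q' : R[X])
    (hQ : p.map ι = Q.map (algebraMap R M))
    (hQ' : (p.comp (X ^ d + C c)).map ι = Q'.map (algebraMap R M)) (hQs : Q'.Splits) (hQ0 : Q' ≠ 0)
    (α₁ : R) (hα₁ : Q.eval α₁ = 0)
    (hact : ∀ β : R, Q'.eval β = 0 → (β ^ d + cR = α₁ → ρ β = ζR * β) ∧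
      (β ^ d + cR ≠ α₁ → ρ β = β)) :
    ∃ τ : (p.comp (X ^ d + C c)).Gal, ∃ α₁ : (p.comp (X ^ d + C c)).SplittingField,
      aeval α₁ p = 0 ∧
      ∀ β : (p.comp (X ^ d + C c)).SplittingField, aeval β (p.comp (X ^ d + C c)) = 0 →
      (β ^ d + algebraMap K _ c = α₁ → τ β = algebraMap K _ ζ * β) ∧
      (β ^ d + algebraMap K _ c ≠ α₁ → τ β = β) := by
  letI : Algebra K M := ι.toAlgebra
  have hι : algebraMap K M = ι := rfl
  obtain ⟨φ, τ, h⟩ := base_general (p.comp (X ^ d + C c))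
    (by rw [hι, hQ']; exact hQs.map _) (T := { T with commutes' := fun x => RingHom.congr_fun hT x })
  replace h : ∀ x, φ (τ x) = T (φ x) := h
  have hqd : (X ^ d + C c : K[X]).natDegree ≠ 0 := by rw [natDegree_X_pow_add_C]; omega
  have hspl := Gal.splits_in_splittingField_of_comp p _ hqd
  obtain ⟨a, haroot, ha⟩ : ∃ a, aeval a p = 0 ∧ φ a = algebraMap R M α₁ := by
    have h1 : algebraMap R M α₁ ∈ p.rootSet M := by
      rw [mem_rootSet]
      refine ⟨hp0, ?_⟩
      rw [← eval_map_algebraMap, hι, hQ, eval_map_apply, hα₁, map_zero]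
    rw [← hspl.image_rootSet φ] at h1
    obtain ⟨a, ha, e⟩ := h1
    exact ⟨a, (mem_rootSet.1 ha).2, e⟩
  refine ⟨τ, a, haroot, fun β hβ => ?_⟩
  obtain ⟨b, hb0, hb⟩ : ∃ b : R, Q'.eval b = 0 ∧ algebraMap R M b = φ β := by
    have h1 : φ β ∈ (Q'.map (algebraMap R M)).roots := by
      rw [mem_roots ((Polynomial.map_ne_zero_iff hRM).2 hQ0), IsRoot, ← hQ', ← hι,
        eval_map_algebraMap, aeval_algHom_apply, hβ, map_zero]
    rw [hQs.roots_map_of_injective hRM, Multiset.mem_map] at h1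
    obtain ⟨b, hb, e⟩ := h1
    exact ⟨b, (mem_roots'.1 hb).2, e⟩
  have hφ : Function.Injective φ := φ.injective
  have hcc : φ (algebraMap K _ c) = algebraMap R M cR := by rw [AlgHom.commutes, hι, hc]
  have hzz : φ (algebraMap K _ ζ) = algebraMap R M ζR := by rw [AlgHom.commutes, hι, hζ]
  have hiff : β ^ d + algebraMap K _ c = a ↔ b ^ d + cR = α₁ := by
    rw [← hφ.eq_iff, ← hRM.eq_iff, map_add, map_pow, hcc, ha, map_add, map_pow, hb]
  obtain ⟨h1, h2⟩ := hact b hb0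
  constructor
  · intro hh
    apply hφ
    rw [h, ← hb, hρ, h1 (hiff.1 hh), map_mul, map_mul, hzz, hb]
  · intro hh
    apply hφ
    rw [h, ← hb, hρ, h2 (fun h' => hh (hiff.2 h'))]

lemma irred_sub_X {k : Type*} [Field k] (g : k[X]) (hg : g.Monic) (hd : 0 < g.natDegree) :
    Irreducible (g.map (algebraMap k (RatFunc k)) - C RatFunc.X) := by
  have h0 : Irreducible (g.map (C : k →+* k[X]) - C X) := by
    have h1 : Irreducible (X - C g : k[X][X]) := irreducible_X_sub_C g
    have h2 := (MulEquiv.irreducible_iff (Bivariate.swap (R := k)).toRingEquiv.toMulEquiv).2 h1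
    have h3 : (Bivariate.swap (R := k)) (X - C g) = - (g.map (C : k →+* k[X]) - C X) := by
      rw [map_sub, Bivariate.swap_Y, Bivariate.swap_C]; ring
    replace h2 : Irreducible ((Bivariate.swap (R := k)) (X - C g)) := h2
    rw [h3] at h2
    exact (Associated.neg_left (Associated.refl _)).irreducible h2
  have hm : (g.map (C : k →+* k[X]) - C X).Monic := by
    apply (hg.map _).sub_of_left
    apply lt_of_le_of_lt degree_C_le
    rwa [← natDegree_pos_iff_degree_pos, hg.natDegree_map]
  have h4 := (hm.irreducible_iff_irreducible_map_fraction_map (K := RatFunc k)).1 h0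
  rw [Polynomial.map_sub, map_map, map_C, RatFunc.algebraMap_X] at h4
  exact h4

variable {k : Type*} [Field k] [CharZero k] (d : ℕ) (hd : 2 ≤ d) (ζ : k)
  (hζ : IsPrimitiveRoot ζ d) (c : k)
  (hw : ∀ m n : ℕ, n < m → (itp (X ^ d + C c) m).eval 0 ≠ (itp (X ^ d + C c) n).eval 0)

/-- The polynomial `f^n - t`. -/
noncomputable def PK (n : ℕ) : (RatFunc k)[X] :=
  (itp (X ^ d + C c) n).map (algebraMap k (RatFunc k)) - C RatFunc.X

lemma PK_succ (n : ℕ) : PK d c (n + 1) =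
    (PK d c n).comp (X ^ d + C (algebraMap k (RatFunc k) c)) := by
  simp [PK, itp_succ', Polynomial.map_comp]

include hd in
lemma PK_facts (n : ℕ) : Irreducible (PK d c n) ∧ (PK d c n).natDegree = d ^ n := by
  have hf : (X ^ d + C c : k[X]).natDegree = d := natDegree_X_pow_add_C
  obtain ⟨h1, h2⟩ := itp_monic_deg (X ^ d + C c : k[X]) (monic_X_pow_add_C _ (by omega))
    (by rw [hf]; omega) n
  rw [hf] at h2
  refine ⟨irred_sub_X _ h1 (by rw [h2]; positivity), ?_⟩
  rw [PK, natDegree_sub_C, h1.natDegree_map, h2]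

include hd hζ hw in
lemma PK_base (n : ℕ) :
    ∃ τ : ((PK d c n).comp (X ^ d + C (algebraMap k (RatFunc k) c))).Gal,
    ∃ α₁ : ((PK d c n).comp (X ^ d + C (algebraMap k (RatFunc k) c))).SplittingField,
      aeval α₁ (PK d c n) = 0 ∧
      ∀ β : ((PK d c n).comp (X ^ d + C (algebraMap k (RatFunc k) c))).SplittingField,
      aeval β ((PK d c n).comp (X ^ d + C (algebraMap k (RatFunc k) c))) = 0 →
      (β ^ d + algebraMap (RatFunc k) _ (algebraMap k (RatFunc k) c) = α₁ →
        τ β = algebraMap (RatFunc k) _ (algebraMap k (RatFunc k) ζ) * β) ∧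
      (β ^ d + algebraMap (RatFunc k) _ (algebraMap k (RatFunc k) c) ≠ α₁ → τ β = β) := by
  let κ := AlgebraicClosure k
  let R := PowerSeries κ
  let M := FractionRing R
  have : CharZero κ := charZero_of_injective_algebraMap (algebraMap k κ).injective
  set j : k →+* κ := algebraMap k κ with hj
  set c' : κ := j c with hc'
  set ζ' : κ := j ζ with hζ'
  have hζp : IsPrimitiveRoot ζ' d := hζ.map_of_injective j.injective
  have hit : ∀ n, itp (X ^ d + C c') n = (itp (X ^ d + C c) n).map j := by
    intro n; rw [itp_map]; simp [hc']
  have hw' : ∀ m n : ℕ, n < m →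
      (itp (X ^ d + C c') m).eval 0 ≠ (itp (X ^ d + C c') n).eval 0 := by
    intro m n hmn h
    rw [hit, hit, ← map_zero j, eval_map_apply, eval_map_apply] at h
    exact hw m n hmn (j.injective h)
  obtain ⟨α₁, hα₁, hact⟩ := PP_action d hd c' hw' ζ' hζp n
  have hRM : Function.Injective (algebraMap R M) := IsFractionRing.injective R M
  set a : κ := (itp (X ^ d + C c') (n + 1)).eval 0 with ha
  set s : R := PowerSeries.C a + PowerSeries.X ^ d with hs
  let θ₀ : k[X] →+* R := eval₂RingHom ((PowerSeries.C (R := κ)).comp j) s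
  have hθ₀ : Function.Injective θ₀ := by
    have e : θ₀ = (Polynomial.coeToPowerSeries.ringHom (R := κ)).comp
        ((compRingHom (C a + X ^ d)).comp (mapRingHom j)) := by
      apply Polynomial.ringHom_ext
      · intro x; simp [θ₀]
      · simp [θ₀, hs]
    have hcomp : Function.Injective (compRingHom (C a + X ^ d : κ[X])) := by
      rw [injective_iff_map_eq_zero]
      intro g hg
      rcases comp_eq_zero_iff.1 hg with h | ⟨-, h⟩
      · exact h
      · have h1 : (C a + X ^ d : κ[X]).natDegree = d := by
          rw [add_comm]; exact natDegree_X_pow_add_C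
        rw [h, natDegree_C] at h1
        omega
    rw [e]
    exact (Polynomial.coe_injective κ).comp (hcomp.comp (map_injective j j.injective))
  have hθ : Function.Injective ((algebraMap R M).comp θ₀) := hRM.comp hθ₀
  let ι : RatFunc k →+* M := IsFractionRing.lift (A := k[X]) hθ
  have hιp : ∀ g : k[X], ι (algebraMap k[X] (RatFunc k) g) = algebraMap R M (θ₀ g) :=
    fun g => IsFractionRing.lift_algebraMap hθ g
  have hιk : ∀ x : k, ι (algebraMap k (RatFunc k) x) = algebraMap R M (PowerSeries.C (j x)) := by
    intro x
    rw [IsScalarTower.algebraMap_apply k k[X] (RatFunc k), hιp]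
    simp [θ₀]
  have hιt : ι RatFunc.X = algebraMap R M s := by
    rw [← RatFunc.algebraMap_X, hιp]
    simp [θ₀]
  have hζ0 : ζ' ≠ 0 := hζp.ne_zero (by omega)
  have hr : Function.Injective ((algebraMap R M).comp (PowerSeries.rescale ζ')) :=
    hRM.comp (PowerSeries.rescale_injective hζ0)
  let T : M →+* M := IsFractionRing.lift (A := R) hr
  have hTR : ∀ x : R, T (algebraMap R M x) = algebraMap R M (PowerSeries.rescale ζ' x) :=
    fun x => IsFractionRing.lift_algebraMap hr x
  have hrC : ∀ x : κ, PowerSeries.rescale ζ' (PowerSeries.C x) = PowerSeries.C x := by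
    intro x
    ext m
    rw [PowerSeries.coeff_rescale, PowerSeries.coeff_C]
    split_ifs with h <;> simp [h]
  have hrs : PowerSeries.rescale ζ' s = s := by
    rw [hs, map_add, hrC, map_pow, PowerSeries.rescale_X, mul_pow, ← map_pow, hζp.pow_eq_one]
    simp
  have hT : T.comp ι = ι := by
    apply IsFractionRing.ringHom_ext (A := k[X])
    intro g
    rw [RingHom.comp_apply, hιp, hTR]
    congr 1
    have : (PowerSeries.rescale ζ').comp θ₀ = θ₀ := by
      apply Polynomial.ringHom_ext
      · intro x; simp [θ₀, hrC]
      · simp [θ₀, hrs]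
    exact RingHom.congr_fun this g
  have hPP : ∀ m, (PK d c m).map ι = (PP d c' n m).map (algebraMap R M) := by
    intro m
    rw [PK, PP, Polynomial.map_sub, Polynomial.map_sub, map_C, map_C, map_map, map_map, hιt, hit,
      map_map]
    congr 2
    ext x
    exact hιk x
  refine transfer hRM ι T hT (PowerSeries.rescale ζ') hTR (PK d c n)
    (PK_facts d hd c n).1.ne_zero d (by omega) _ _ (PowerSeries.C c') (PowerSeries.C ζ')
    (hιk c) (hιk ζ) (PP d c' n n) (PP d c' n (n + 1)) (hPP n) ?_
    (PP_splits d hd c' hw' ζ' hζp n (n + 1) le_rfl) (PP_monic d hd c' n (n + 1)).ne_zero α₁ hα₁ hact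
  rw [← PK_succ, hPP]

include hd hζ hw in
lemma PK_card (N : ℕ) : Nat.card (PK d c N).Gal = d ^ (∑ i ∈ Finset.range N, d ^ i) := by
  induction N with
  | zero =>
    have : PK d c 0 = X - C RatFunc.X := by simp [PK, itp_zero]
    rw [this]
    simp
  | succ n ih =>
    obtain ⟨h1, h2⟩ := PK_facts d hd c n
    have : CharZero (RatFunc k) :=
      charZero_of_injective_algebraMap (algebraMap k (RatFunc k)).injective
    rw [PK_succ, gal_card_succ (PK d c n) d (by omega) (algebraMap k (RatFunc k) ζ)
      (hζ.map_of_injective (algebraMap k (RatFunc k)).injective) _ h1 h1.separable ?_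
      (PK_base d hd ζ hζ c hw n), ih, h2, Finset.sum_range_succ, pow_add]
    rw [PK, eval_sub, eval_C, eval_map_apply, sub_ne_zero,
      IsScalarTower.algebraMap_apply k k[X] (RatFunc k), ← RatFunc.algebraMap_X]
    intro h
    exact X_ne_C _ (RatFunc.algebraMap_injective k h).symm

end transfer
end Unicrit

/-- Let `k` be a number field containing a primitive `d`-th root of
unity (`d ≥ 2`), `f(x) = x^d + c` with `c ∈ k`, and suppose `0` is not preperiodic
under `f`.  Then for every `N ≥ 1` the Galois group of a splitting field of
`f^{∘N}(x) − t` over `k(t)` has order `d^{(d^N − 1)/(d − 1)}`, the order of the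
`N`-fold wreath product `[C_d]^N`. -/
theorem gal_iterate_unicritical_card {k : Type*} [Field k] [NumberField k]
    (d : ℕ) (hd : 2 ≤ d) (ζ : k) (hζ : IsPrimitiveRoot ζ d)
    (c : k) (f : Polynomial k) (hf : f = X ^ d + C c)
    (hwander : ∀ m n : ℕ, n < m → (fun z => f.eval z)^[m] 0 ≠ (fun z => f.eval z)^[n] 0)
    (N : ℕ) (hN : 1 ≤ N) :
    Nat.card (((fun g => f.comp g)^[N] Polynomial.X).map (algebraMap k (RatFunc k)) -
        Polynomial.C RatFunc.X).Gal =
      d ^ ((d ^ N - 1) / (d - 1)) := by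
  subst hf
  have h := Unicrit.PK_card d hd ζ hζ c (fun m n hmn => by
    rw [Unicrit.itp_eval, Unicrit.itp_eval]; exact hwander m n hmn) N
  rw [Nat.geomSum_eq hd] at h
  exact h
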